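/- Let α, β > −1 be reals, let n, r be integers with 0 ≤ r ≤ n, and let f : [0,1] → ℝ be (r+2) times continuously differentiable. Then ‖ (M_n^{(α,β)} f)^{(r)} − M_{n−r}^{(α,β)}(f^{(r)}) ‖ ≤ (r(α+β+r+1)/(n+α+β+2))·‖f^{(r)}‖ + (1/4)·‖f^{(r+2)}‖·(n+α+β+3)/((n+α+β+3)² − r²) + ω(f^{(r)}, r(n−r+|β−α|)/((n+2+α+β)² − r²)). -/

import Mathlib

/-- Bernstein basis polynomial `p_{n,k}(x) = C(n,k) x^k (1-x)^{n-k}`. -/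
noncomputable def bern (n k : ℕ) (x : ℝ) : ℝ :=
  (n.choose k : ℝ) * x ^ k * (1 - x) ^ (n - k)

/-- Durrmeyer operator with Jacobi weight `t^α (1-t)^β`:
`M_n^{(α,β)}(f;x) = Σ_{k=0}^n p_{n,k}(x) (1/c_{n,k}^{(α,β)}) ∫₀¹ p_{n,k}(t) t^α (1-t)^β f(t) dt`. -/
noncomputable def durrmeyerJ (α β : ℝ) (n : ℕ) (f : ℝ → ℝ) (x : ℝ) : ℝ :=
  ∑ k ∈ Finset.range (n + 1), bern n k x *
    ((∫ t in (0:ℝ)..1, bern n k t * t ^ α * (1 - t) ^ β * f t) /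
      (∫ t in (0:ℝ)..1, bern n k t * t ^ α * (1 - t) ^ β))

/-- Supremum norm on `[0,1]`. -/
noncomputable def supNorm (g : ℝ → ℝ) : ℝ :=
  ⨆ x : Set.Icc (0:ℝ) 1, |g x|

/-- First modulus of continuity on `[0,1]`. -/
noncomputable def modCont (g : ℝ → ℝ) (δ : ℝ) : ℝ :=
  sSup {d : ℝ | ∃ x ∈ Set.Icc (0:ℝ) 1, ∃ y ∈ Set.Icc (0:ℝ) 1, |x - y| ≤ δ ∧ d = |g x - g y|}


open MeasureTheory intervalIntegral Set

/-- The Jacobi functional `f ↦ ∫₀¹ t^a (1-t)^b f(t) dt`. -/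
noncomputable def jacobiInt (a b : ℝ) (f : ℝ → ℝ) : ℝ :=
  ∫ t in (0:ℝ)..1, t ^ a * (1 - t) ^ b * f t

/-- The mean of `f` under the probability density proportional to `t^a (1-t)^b` on `[0,1]`. -/
noncomputable def jacobiMean (a b : ℝ) (f : ℝ → ℝ) : ℝ :=
  jacobiInt a b f / jacobiInt a b fun _ => 1

section JacobiInt

variable {a b : ℝ}

lemma intervalIntegrable_jacobiWeight (ha : -1 < a) (hb : -1 < b) :
    IntervalIntegrable (fun t : ℝ => t ^ a * (1 - t) ^ b) volume 0 1 := by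
  have h := (Complex.betaIntegral_convergent (u := (a + 1 : ℝ)) (v := (b + 1 : ℝ))
    (by rw [Complex.ofReal_re]; linarith) (by rw [Complex.ofReal_re]; linarith)).norm
  refine h.congr_uIoo fun t ht => ?_
  rw [uIoo_of_le zero_le_one] at ht
  have h0 : 0 < 1 - t := by linarith [ht.2]
  simp only [norm_mul]
  congr 1
  · rw [Complex.norm_cpow_eq_rpow_re_of_pos ht.1]; simp
  · rw [← Complex.ofReal_one, ← Complex.ofReal_sub, Complex.norm_cpow_eq_rpow_re_of_pos h0]; simp

lemma intervalIntegrable_jacobi (ha : -1 < a) (hb : -1 < b) {f : ℝ → ℝ} (hf : Continuous f) :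
    IntervalIntegrable (fun t : ℝ => t ^ a * (1 - t) ^ b * f t) volume 0 1 :=
  (intervalIntegrable_jacobiWeight ha hb).mul_continuousOn hf.continuousOn

lemma jacobiInt_add (ha : -1 < a) (hb : -1 < b) {f g : ℝ → ℝ} (hf : Continuous f)
    (hg : Continuous g) :
    jacobiInt a b (fun t => f t + g t) = jacobiInt a b f + jacobiInt a b g := by
  unfold jacobiInt
  rw [← integral_add (intervalIntegrable_jacobi ha hb hf) (intervalIntegrable_jacobi ha hb hg)]
  simp only [mul_add]

lemma jacobiInt_const_mul (c : ℝ) (f : ℝ → ℝ) :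
    jacobiInt a b (fun t => c * f t) = c * jacobiInt a b f := by
  unfold jacobiInt
  rw [← intervalIntegral.integral_const_mul]
  simp only [mul_left_comm]

lemma jacobiInt_mono (ha : -1 < a) (hb : -1 < b) {f g : ℝ → ℝ} (hf : Continuous f)
    (hg : Continuous g) (h : ∀ t ∈ Icc (0:ℝ) 1, f t ≤ g t) : jacobiInt a b f ≤ jacobiInt a b g := by
  refine integral_mono_on zero_le_one (intervalIntegrable_jacobi ha hb hf)
    (intervalIntegrable_jacobi ha hb hg) fun t ht => ?_
  exact mul_le_mul_of_nonneg_left (h t ht)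
    (mul_nonneg (Real.rpow_nonneg ht.1 _) (Real.rpow_nonneg (by linarith [ht.2]) _))

lemma jacobiInt_one_pos (ha : -1 < a) (hb : -1 < b) : 0 < jacobiInt a b fun _ => 1 := by
  refine intervalIntegral_pos_of_pos_on (intervalIntegrable_jacobi ha hb continuous_const)
    (fun t ht => ?_) zero_lt_one
  have := Real.rpow_pos_of_pos ht.1 a
  have := Real.rpow_pos_of_pos (sub_pos.2 ht.2) b
  positivity

lemma jacobiInt_add_one_left (ha : -1 < a) (f : ℝ → ℝ) :
    jacobiInt (a + 1) b f = jacobiInt a b fun t => t * f t := by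
  refine integral_congr fun t ht => ?_
  rw [uIcc_of_le zero_le_one] at ht
  simp only [Real.rpow_add_one' ht.1 (by linarith : a + 1 ≠ 0)]
  ring

lemma jacobiInt_add_one_right (hb : -1 < b) (f : ℝ → ℝ) :
    jacobiInt a (b + 1) f = jacobiInt a b fun t => (1 - t) * f t := by
  refine integral_congr fun t ht => ?_
  rw [uIcc_of_le zero_le_one] at ht
  simp only [Real.rpow_add_one' (sub_nonneg.2 ht.2) (by linarith : b + 1 ≠ 0)]
  ring

lemma jacobiInt_eq_add (ha : -1 < a) (hb : -1 < b) {f : ℝ → ℝ} (hf : Continuous f) :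
    jacobiInt a b f = jacobiInt (a + 1) b f + jacobiInt a (b + 1) f := by
  rw [jacobiInt_add_one_left ha, jacobiInt_add_one_right hb,
    ← jacobiInt_add ha hb (by fun_prop) (by fun_prop)]
  congr 1; ext t; ring

lemma jacobiInt_integration_by_parts (ha : -1 < a) (hb : -1 < b) {f f' : ℝ → ℝ}
    (hf : ∀ t, HasDerivAt f (f' t) t) (hf' : Continuous f') :
    jacobiInt (a + 1) (b + 1) f' =
      (b + 1) * jacobiInt (a + 1) b f - (a + 1) * jacobiInt a (b + 1) f := by
  have hfc : Continuous f := continuous_iff_continuousAt.2 fun t => (hf t).continuousAt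
  have ha' : 0 < a + 1 := by linarith
  have hb' : 0 < b + 1 := by linarith
  have i₁ := (intervalIntegrable_jacobi (by linarith : -1 < a) (by linarith : -1 < b + 1)
    hfc).const_mul (a + 1)
  have i₂ := (intervalIntegrable_jacobi (by linarith : -1 < a + 1) (by linarith : -1 < b)
    hfc).const_mul (b + 1)
  have i₃ := intervalIntegrable_jacobi (by linarith : -1 < a + 1) (by linarith : -1 < b + 1) hf'
  have e := integral_add (i₁.sub i₂) i₃
  rw [integral_sub i₁ i₂, intervalIntegral.integral_const_mul,
    intervalIntegral.integral_const_mul] at e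
  have z : (∫ t in (0:ℝ)..1, ((a + 1) * (t ^ a * (1 - t) ^ (b + 1) * f t) -
      (b + 1) * (t ^ (a + 1) * (1 - t) ^ b * f t)) + t ^ (a + 1) * (1 - t) ^ (b + 1) * f' t) = 0 := by
    rw [integral_eq_sub_of_hasDerivAt_of_le (zero_le_one (α := ℝ))
      (f := fun t => t ^ (a + 1) * (1 - t) ^ (b + 1) * f t)
      (((continuous_id.rpow_const fun _ => Or.inr ha'.le).mul
        ((continuous_const.sub continuous_id).rpow_const fun _ => Or.inr hb'.le)).mul
          hfc).continuousOn (fun t ht => ?_) ((i₁.sub i₂).add i₃)]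
    · simp [Real.zero_rpow ha'.ne', Real.zero_rpow hb'.ne']
    · have h1 := (hasDerivAt_id' t).rpow_const (p := a + 1) (Or.inl ht.1.ne')
      have h2 := ((hasDerivAt_id' t).const_sub 1).rpow_const (p := b + 1)
        (Or.inl (sub_pos.2 ht.2).ne')
      refine ((h1.mul h2).mul (hf t)).congr_deriv ?_
      simp only [Pi.mul_apply, add_sub_cancel_right]
      ring
  unfold jacobiInt
  linarith

lemma jacobiInt_one_add_one_left (ha : -1 < a) (hb : -1 < b) :
    (jacobiInt (a + 1) b fun _ => 1) = (a + 1) / (a + b + 2) * jacobiInt a b fun _ => 1 := by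
  have h := jacobiInt_integration_by_parts ha hb (fun t => hasDerivAt_const t (1:ℝ))
    continuous_const
  have h0 : (jacobiInt (a + 1) (b + 1) fun _ => (0:ℝ)) = 0 := by simp [jacobiInt]
  have h2 := jacobiInt_eq_add ha hb (continuous_const (y := (1:ℝ)))
  have : 0 < a + b + 2 := by linarith
  field_simp
  rw [h2]
  linarith

lemma jacobiInt_one_add_one_right (ha : -1 < a) (hb : -1 < b) :
    (jacobiInt a (b + 1) fun _ => 1) = (b + 1) / (a + b + 2) * jacobiInt a b fun _ => 1 := by
  have h2 := jacobiInt_eq_add ha hb (continuous_const (y := (1:ℝ)))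
  have h1 := jacobiInt_one_add_one_left ha hb
  have : 0 < a + b + 2 := by linarith
  rw [eq_sub_of_add_eq' h2.symm, h1]
  field_simp
  ring

end JacobiInt

section JacobiMean

variable {a b : ℝ}

lemma jacobiMean_add (ha : -1 < a) (hb : -1 < b) {f g : ℝ → ℝ} (hf : Continuous f)
    (hg : Continuous g) :
    jacobiMean a b (fun t => f t + g t) = jacobiMean a b f + jacobiMean a b g := by
  rw [jacobiMean, jacobiInt_add ha hb hf hg, add_div]; rfl

lemma jacobiMean_const_mul (c : ℝ) (f : ℝ → ℝ) :
    jacobiMean a b (fun t => c * f t) = c * jacobiMean a b f := by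
  rw [jacobiMean, jacobiInt_const_mul, mul_div_assoc]; rfl

lemma jacobiMean_mono (ha : -1 < a) (hb : -1 < b) {f g : ℝ → ℝ} (hf : Continuous f)
    (hg : Continuous g) (h : ∀ t ∈ Icc (0:ℝ) 1, f t ≤ g t) :
    jacobiMean a b f ≤ jacobiMean a b g :=
  div_le_div_of_nonneg_right (jacobiInt_mono ha hb hf hg h) (jacobiInt_one_pos ha hb).le

lemma jacobiMean_const (ha : -1 < a) (hb : -1 < b) (c : ℝ) : (jacobiMean a b fun _ => c) = c := by
  have h := jacobiMean_const_mul (a := a) (b := b) c fun _ => 1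
  simp only [mul_one] at h
  rw [h, jacobiMean, div_self (jacobiInt_one_pos ha hb).ne', mul_one]

lemma abs_jacobiMean_le (ha : -1 < a) (hb : -1 < b) {f g : ℝ → ℝ} (hf : Continuous f)
    (hg : Continuous g) (h : ∀ t ∈ Icc (0:ℝ) 1, |f t| ≤ g t) :
    |jacobiMean a b f| ≤ jacobiMean a b g := by
  refine abs_le.2 ⟨?_, jacobiMean_mono ha hb hf hg fun t ht => (abs_le.1 (h t ht)).2⟩
  rw [neg_eq_neg_one_mul, ← jacobiMean_const_mul]
  exact jacobiMean_mono ha hb (by fun_prop) hf fun t ht => by linarith [(abs_le.1 (h t ht)).1]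

lemma jacobiMean_id (ha : -1 < a) (hb : -1 < b) :
    (jacobiMean a b fun t => t) = (a + 1) / (a + b + 2) := by
  have h := jacobiInt_add_one_left (b := b) ha fun _ => 1
  simp only [mul_one] at h
  rw [jacobiMean, ← h, jacobiInt_one_add_one_left ha hb,
    mul_div_cancel_right₀ _ (jacobiInt_one_pos ha hb).ne']

lemma jacobiMean_sq (ha : -1 < a) (hb : -1 < b) :
    (jacobiMean a b fun t => t ^ 2) = (a + 1) * (a + 2) / ((a + b + 2) * (a + b + 3)) := by
  have h := jacobiInt_add_one_left (b := b) (by linarith : -1 < a + 1) fun _ => 1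
  rw [jacobiInt_add_one_left ha] at h
  simp only [mul_one, ← sq] at h
  rw [jacobiMean, ← h, jacobiInt_one_add_one_left (by linarith) hb,
    jacobiInt_one_add_one_left ha hb, ← mul_assoc,
    mul_div_cancel_right₀ _ (jacobiInt_one_pos ha hb).ne', div_mul_div_comm]
  ring_nf

lemma jacobiMean_sub_mean (ha : -1 < a) (hb : -1 < b) :
    (jacobiMean a b fun t => t - (a + 1) / (a + b + 2)) = 0 := by
  simp only [sub_eq_add_neg]
  rw [jacobiMean_add ha hb (by fun_prop) (by fun_prop), jacobiMean_const ha hb,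
    jacobiMean_id ha hb, add_neg_cancel]

lemma jacobiMean_variance_le (ha : -1 < a) (hb : -1 < b) :
    (jacobiMean a b fun t => (t - (a + 1) / (a + b + 2)) ^ 2) ≤ 1 / (4 * (a + b + 3)) := by
  have hs : 0 < a + b + 2 := by linarith
  have hs' : 0 < a + b + 3 := by linarith
  set m := (a + 1) / (a + b + 2) with hm
  have e : (fun t : ℝ => (t - m) ^ 2) = fun t => t ^ 2 + ((-2 * m) * t + m ^ 2) := by
    ext t; ring
  rw [e, jacobiMean_add ha hb (by fun_prop) (by fun_prop),
    jacobiMean_add ha hb (by fun_prop) (by fun_prop), jacobiMean_const ha hb,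
    jacobiMean_const_mul, jacobiMean_id ha hb, jacobiMean_sq ha hb, ← hm]
  have h1 : (a + 1) * (a + 2) / ((a + b + 2) * (a + b + 3)) + (-2 * m * m + m ^ 2) =
      m * (1 - m) / (a + b + 3) := by
    rw [hm]; field_simp; ring
  rw [h1, div_le_div_iff₀ hs' (by positivity)]
  nlinarith [mul_nonneg hs'.le (sq_nonneg (2 * m - 1))]

lemma jacobiMean_shift_sub (ha : -1 < a) (hb : -1 < b) {f f' : ℝ → ℝ}
    (hf : ∀ t, HasDerivAt f (f' t) t) (hf' : Continuous f') :
    jacobiMean (a + 1) b f - jacobiMean a (b + 1) f =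
      jacobiMean (a + 1) (b + 1) f' / (a + b + 3) := by
  have ha' : 0 < a + 1 := by linarith
  have hb' : 0 < b + 1 := by linarith
  have hs : 0 < a + b + 2 := by linarith
  have hs' : 0 < a + b + 3 := by linarith
  have hs'' : a + 1 + b + 2 = a + b + 3 := by ring
  have hp := (jacobiInt_one_pos ha hb).ne'
  simp only [jacobiMean]
  rw [jacobiInt_integration_by_parts ha hb hf hf',
    jacobiInt_one_add_one_right (by linarith : -1 < a + 1) hb, jacobiInt_one_add_one_left ha hb,
    jacobiInt_one_add_one_right ha hb, hs'']
  field_simp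

end JacobiMean

section Taylor

lemma abs_sub_tangent_le {g : ℝ → ℝ} (hg : ContDiff ℝ 2 g) {M m t : ℝ}
    (hM : ∀ x ∈ Icc (0:ℝ) 1, |iteratedDeriv 2 g x| ≤ M) (hm : m ∈ Icc (0:ℝ) 1)
    (ht : t ∈ Icc (0:ℝ) 1) : |g t - g m - deriv g m * (t - m)| ≤ M / 2 * (t - m) ^ 2 := by
  rcases eq_or_ne m t with rfl | h
  · simp
  obtain ⟨y, hy, e⟩ := taylor_mean_remainder_lagrange_iteratedDeriv (n := 1) h
    (hg.contDiffOn (s := uIcc m t))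
  have hd : derivWithin g (uIcc m t) m = deriv g m :=
    (hg.differentiable (by norm_num) m).derivWithin (uniqueDiffOn_uIcc h m left_mem_uIcc)
  have e' : g t - g m - deriv g m * (t - m) = iteratedDeriv 2 g y / 2 * (t - m) ^ 2 := by
    rw [taylorWithinEval_succ, taylor_within_zero_eval, iteratedDerivWithin_one, hd] at e
    simp [Nat.factorial] at e
    linarith
  have hy' : y ∈ Icc (0:ℝ) 1 := uIcc_subset_Icc hm ht (Ioo_subset_Icc_self hy)
  rw [e', abs_mul, abs_of_nonneg (sq_nonneg (t - m)), abs_div, abs_two]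
  gcongr
  exact hM y hy'

lemma abs_jacobiMean_sub_le {a b : ℝ} (ha : -1 < a) (hb : -1 < b) {g : ℝ → ℝ}
    (hg : ContDiff ℝ 2 g) {M : ℝ} (hM : ∀ x ∈ Icc (0:ℝ) 1, |iteratedDeriv 2 g x| ≤ M) :
    |jacobiMean a b g - g ((a + 1) / (a + b + 2))| ≤ M / 8 * (1 / (a + b + 3)) := by
  have hs : 0 < a + b + 2 := by linarith
  have hM0 : 0 ≤ M := (abs_nonneg _).trans (hM 0 ⟨le_rfl, zero_le_one⟩)
  have hc := hg.continuous
  have hv := jacobiMean_variance_le ha hb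
  have h0 := jacobiMean_sub_mean ha hb
  have hm : (a + 1) / (a + b + 2) ∈ Icc (0:ℝ) 1 :=
    ⟨div_nonneg (by linarith) hs.le, (div_le_one hs).2 (by linarith)⟩
  set m := (a + 1) / (a + b + 2)
  have e : g = fun t => (g t - g m - deriv g m * (t - m)) + (g m + deriv g m * (t - m)) := by
    ext t; ring
  have e2 : jacobiMean a b g - g m = jacobiMean a b fun t => g t - g m - deriv g m * (t - m) := by
    conv_lhs => rw [e]
    rw [jacobiMean_add ha hb (by fun_prop) (by fun_prop),
      jacobiMean_add ha hb (by fun_prop) (by fun_prop), jacobiMean_const ha hb,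
      jacobiMean_const_mul, h0]
    ring
  rw [e2]
  calc _ ≤ jacobiMean a b fun t => M / 2 * (t - m) ^ 2 :=
        abs_jacobiMean_le ha hb (by fun_prop) (by fun_prop) fun t ht =>
          abs_sub_tangent_le hg hM hm ht
    _ ≤ M / 2 * (1 / (4 * (a + b + 3))) := by
        rw [jacobiMean_const_mul]
        gcongr
    _ = _ := by rw [← one_div_mul_one_div]; ring

end Taylor

section Bernstein

lemma bern_eq_eval (n k : ℕ) (x : ℝ) : bern n k x = (bernsteinPolynomial ℝ n k).eval x := by
  simp [bern, bernsteinPolynomial]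

lemma bern_nonneg (n k : ℕ) {x : ℝ} (hx : x ∈ Icc (0:ℝ) 1) : 0 ≤ bern n k x := by
  have := sub_nonneg.2 hx.2
  have := hx.1
  unfold bern
  positivity

lemma sum_bern (n : ℕ) (x : ℝ) : ∑ k ∈ Finset.range (n + 1), bern n k x = 1 := by
  simp only [bern_eq_eval, ← Polynomial.eval_finsetSum, bernsteinPolynomial.sum,
    Polynomial.eval_one]

lemma abs_sum_bern_mul_le (n : ℕ) {x : ℝ} (hx : x ∈ Icc (0:ℝ) 1) {c : ℕ → ℝ} {C : ℝ}
    (h : ∀ k ≤ n, |c k| ≤ C) : |∑ k ∈ Finset.range (n + 1), bern n k x * c k| ≤ C := by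
  calc _ ≤ ∑ k ∈ Finset.range (n + 1), bern n k x * C := by
        refine (Finset.abs_sum_le_sum_abs _ _).trans (Finset.sum_le_sum fun k hk => ?_)
        rw [abs_mul, abs_of_nonneg (bern_nonneg n k hx)]
        exact mul_le_mul_of_nonneg_left (h k (Nat.lt_succ_iff.1 (Finset.mem_range.1 hk)))
          (bern_nonneg n k hx)
    _ = C := by rw [← Finset.sum_mul, sum_bern, one_mul]

lemma hasDerivAt_sum_bern (n : ℕ) (c : ℕ → ℝ) (x : ℝ) :
    HasDerivAt (fun x => ∑ k ∈ Finset.range (n + 2), bern (n + 1) k x * c k)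
      ((n + 1) * ∑ k ∈ Finset.range (n + 1), bern n k x * (c (k + 1) - c k)) x := by
  have h : HasDerivAt (fun x => ∑ k ∈ Finset.range (n + 2), bern (n + 1) k x * c k)
      (∑ k ∈ Finset.range (n + 2),
        (Polynomial.derivative (bernsteinPolynomial ℝ (n + 1) k)).eval x * c k) x := by
    simp only [bern_eq_eval]
    exact HasDerivAt.fun_sum fun k _ => (Polynomial.hasDerivAt _ x).mul_const _
  refine h.congr_deriv ?_
  have hz : bern n (n + 1) x = 0 := by simp [bern]
  have hs : ∑ k ∈ Finset.range (n + 1), bern n (k + 1) x * c (k + 1) + bern n 0 x * c 0 =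
      ∑ k ∈ Finset.range (n + 1), bern n k x * c k := by
    rw [← Finset.sum_range_succ' (fun k => bern n k x * c k), Finset.sum_range_succ, hz]
    simp
  rw [Finset.sum_range_succ', bernsteinPolynomial.derivative_zero]
  simp only [bernsteinPolynomial.derivative_succ, Polynomial.eval_mul, Polynomial.eval_sub,
    Polynomial.eval_neg, Polynomial.eval_add, Polynomial.eval_one, Polynomial.eval_natCast, ← bern_eq_eval, Nat.add_sub_cancel, mul_sub,
    Finset.sum_sub_distrib, ← hs, Nat.cast_add, Nat.cast_one]
  simp only [sub_mul, Finset.sum_sub_distrib, mul_assoc, ← Finset.mul_sum]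
  ring

end Bernstein

section Durrmeyer

variable {α β : ℝ}

lemma integral_bern_mul {n k : ℕ} (hk : k ≤ n) (f : ℝ → ℝ) :
    (∫ t in (0:ℝ)..1, bern n k t * t ^ α * (1 - t) ^ β * f t) =
      n.choose k * jacobiInt (k + α) (n - k + β) f := by
  rw [jacobiInt, ← intervalIntegral.integral_const_mul]
  refine integral_congr_Ioo_of_le zero_le_one fun t ht => ?_
  simp only [bern]
  rw [Real.rpow_add ht.1, Real.rpow_add (sub_pos.2 ht.2), ← Nat.cast_sub hk, Real.rpow_natCast,
    Real.rpow_natCast]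
  ring

lemma durrmeyerJ_eq_sum (n : ℕ) (f : ℝ → ℝ) (x : ℝ) :
    durrmeyerJ α β n f x =
      ∑ k ∈ Finset.range (n + 1), bern n k x * jacobiMean (k + α) (n - k + β) f := by
  refine Finset.sum_congr rfl fun k hk => ?_
  have hk' : k ≤ n := Nat.lt_succ_iff.1 (Finset.mem_range.1 hk)
  have h1 := integral_bern_mul (α := α) (β := β) hk' fun _ => 1
  simp only [mul_one] at h1
  have hc : (n.choose k : ℝ) ≠ 0 := Nat.cast_ne_zero.2 (Nat.choose_pos hk').ne'
  rw [integral_bern_mul hk', h1, mul_div_mul_left _ _ hc, jacobiMean]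

lemma neg_one_lt_natCast_add (hα : -1 < α) (k : ℕ) : -1 < (k : ℝ) + α := by
  have : (0:ℝ) ≤ k := k.cast_nonneg
  linarith

lemma neg_one_lt_natCast_sub_add (hβ : -1 < β) {n k : ℕ} (hk : k ≤ n) :
    -1 < (n : ℝ) - k + β := by
  have : (k:ℝ) ≤ n := by exact_mod_cast hk
  linarith

lemma deriv_durrmeyerJ_succ (hα : -1 < α) (hβ : -1 < β) (n : ℕ) {f : ℝ → ℝ}
    (hf : ContDiff ℝ 1 f) :
    deriv (durrmeyerJ α β (n + 1) f) = fun x =>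
      (n + 1) / (n + α + β + 3) * durrmeyerJ (α + 1) (β + 1) n (deriv f) x := by
  ext x
  rw [funext (durrmeyerJ_eq_sum (n + 1) f), durrmeyerJ_eq_sum,
    (hasDerivAt_sum_bern n (fun k => jacobiMean (k + α) ((n + 1 : ℕ) - k + β) f) x).deriv,
    div_mul_eq_mul_div, mul_div_assoc, Finset.sum_div]
  congr 1
  refine Finset.sum_congr rfl fun k hk => ?_
  have hk' : k ≤ n := Nat.lt_succ_iff.1 (Finset.mem_range.1 hk)
  have h := jacobiMean_shift_sub (neg_one_lt_natCast_add hα k) (neg_one_lt_natCast_sub_add hβ hk')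
    (fun t => (hf.differentiable one_ne_zero t).hasDerivAt) (hf.continuous_deriv le_rfl)
  push_cast
  rw [mul_div_assoc]
  congr 1
  rw [show (n:ℝ) + α + β + 3 = k + α + (n - k + β) + 3 by ring, ← add_assoc (k:ℝ),
    ← add_assoc ((n:ℝ) - k), ← h]
  ring_nf

lemma iteratedDeriv_durrmeyerJ (r : ℕ) : ∀ {α β : ℝ}, -1 < α → -1 < β → ∀ (m : ℕ) {f : ℝ → ℝ},
    ContDiff ℝ r f → ∃ γ : ℝ, 0 ≤ γ ∧ γ ≤ 1 ∧
      1 - γ ≤ r * (α + β + r + 1) / ((m + r : ℕ) + α + β + 2) ∧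
      iteratedDeriv r (durrmeyerJ α β (m + r) f) = fun x =>
        γ * durrmeyerJ (α + r) (β + r) m (iteratedDeriv r f) x := by
  induction r with
  | zero =>
    intro α β _ _ m f _
    exact ⟨1, zero_le_one, le_rfl, by simp, by simp⟩
  | succ r ih =>
    intro α β hα hβ m f hf
    obtain ⟨γ, h0, h1, hγ, e⟩ := ih (α := α + 1) (β := β + 1) (by linarith) (by linarith) m
      (f := deriv f) (by
        have : ContDiff ℝ ((r : WithTop ℕ∞) + 1) f := by exact_mod_cast hf
        exact (contDiff_succ_iff_deriv.1 this).2.2)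
    have hf1 : ContDiff ℝ 1 f := hf.of_le (by exact_mod_cast Nat.le_add_left 1 r)
    have hN : (0:ℝ) ≤ (m + r : ℕ) := Nat.cast_nonneg _
    have hr : (0:ℝ) ≤ r := Nat.cast_nonneg _
    have hD : 0 < ((m + r : ℕ) : ℝ) + α + β + 3 := by linarith
    set q : ℝ := ((m + r : ℕ) + 1) / ((m + r : ℕ) + α + β + 3) with hq
    have hq0 : 0 ≤ q := by positivity
    have hq1 : q ≤ 1 := (div_le_one hD).2 (by linarith)
    refine ⟨q * γ, mul_nonneg hq0 h0, mul_le_one₀ hq1 h0 h1, ?_, ?_⟩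
    · have hγ' : 1 - γ ≤ r * (α + β + r + 3) / ((m + r : ℕ) + α + β + 3) := by
        refine hγ.trans ?_
        rw [show α + 1 + (β + 1) + (r:ℝ) + 1 = α + β + r + 3 by ring]
        have : 0 ≤ r * (α + β + r + 3) := mul_nonneg hr (by linarith)
        exact div_le_div_of_nonneg_left this hD (by linarith)
      have hq' : 1 - q = (α + β + 2) / ((m + r : ℕ) + α + β + 3) := by
        rw [hq]; field_simp; ring
      calc 1 - q * γ ≤ (1 - q) + (1 - γ) := by nlinarith
        _ ≤ (α + β + 2) / ((m + r : ℕ) + α + β + 3) +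
            r * (α + β + r + 3) / ((m + r : ℕ) + α + β + 3) := by linarith
        _ = _ := by
          rw [← add_div]
          push_cast
          congr 1 <;> ring
    · rw [iteratedDeriv_succ', ← Nat.add_assoc, deriv_durrmeyerJ_succ hα hβ (m + r) hf1, ← hq]
      ext x
      rw [iteratedDeriv_const_mul_field, e, iteratedDeriv_succ', mul_assoc, Nat.cast_succ,
        add_right_comm α 1, add_right_comm β 1, add_assoc α, add_assoc β]

end Durrmeyer

section Norms

lemma bddAbove_range_abs {g : ℝ → ℝ} (hg : Continuous g) :
    BddAbove (range fun x : Icc (0:ℝ) 1 => |g x|) :=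
  (isCompact_range (by fun_prop)).bddAbove

lemma abs_le_supNorm {g : ℝ → ℝ} (hg : Continuous g) {x : ℝ} (hx : x ∈ Icc (0:ℝ) 1) :
    |g x| ≤ supNorm g :=
  le_ciSup (bddAbove_range_abs hg) (⟨x, hx⟩ : Icc (0:ℝ) 1)

lemma abs_sub_le_modCont {g : ℝ → ℝ} (hg : Continuous g) {x y δ : ℝ} (hx : x ∈ Icc (0:ℝ) 1)
    (hy : y ∈ Icc (0:ℝ) 1) (h : |x - y| ≤ δ) : |g x - g y| ≤ modCont g δ := by
  refine le_csSup ⟨supNorm g + supNorm g, ?_⟩ ⟨x, hx, y, hy, h, rfl⟩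
  rintro _ ⟨u, hu, v, hv, -, rfl⟩
  exact (abs_sub _ _).trans (add_le_add (abs_le_supNorm hg hu) (abs_le_supNorm hg hv))

end Norms

section Difference

variable {α β : ℝ}

lemma abs_durrmeyerJ_le_supNorm (hα : -1 < α) (hβ : -1 < β) (n : ℕ) {g : ℝ → ℝ}
    (hg : Continuous g) {x : ℝ} (hx : x ∈ Icc (0:ℝ) 1) : |durrmeyerJ α β n g x| ≤ supNorm g := by
  rw [durrmeyerJ_eq_sum]
  refine abs_sum_bern_mul_le n hx fun k hk => ?_
  have ha := neg_one_lt_natCast_add hα k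
  have hb := neg_one_lt_natCast_sub_add hβ hk
  exact (abs_jacobiMean_le ha hb hg continuous_const fun t ht => abs_le_supNorm hg ht).trans_eq
    (jacobiMean_const ha hb _)

lemma abs_mean_shift_sub_le (hα : -1 < α) (hβ : -1 < β) {m k r : ℝ} (hk : 0 ≤ k) (hkm : k ≤ m)
    (hr : 0 ≤ r) :
    |(k + α + r + 1) / (m + α + β + 2 * r + 2) - (k + α + 1) / (m + α + β + 2)| ≤
      r * (m + |β - α|) / ((m + r + 2 + α + β) ^ 2 - r ^ 2) := by
  have h1 : 0 < m + α + β + 2 := by linarith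
  have h2 : 0 < m + α + β + 2 * r + 2 := by linarith
  have e : (m + r + 2 + α + β) ^ 2 - r ^ 2 = (m + α + β + 2 * r + 2) * (m + α + β + 2) := by ring
  have e' : (k + α + r + 1) / (m + α + β + 2 * r + 2) - (k + α + 1) / (m + α + β + 2) =
      r * (m - 2 * k + (β - α)) / ((m + r + 2 + α + β) ^ 2 - r ^ 2) := by
    rw [e, div_sub_div _ _ h2.ne' h1.ne']; congr 1; ring
  have hD : 0 < (m + r + 2 + α + β) ^ 2 - r ^ 2 := e ▸ mul_pos h2 h1
  rw [e', abs_div, abs_mul, abs_of_nonneg hr, abs_of_pos hD]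
  gcongr
  refine (abs_add_le _ _).trans ?_
  gcongr
  exact abs_le.2 ⟨by linarith, by linarith⟩

lemma abs_durrmeyerJ_shift_sub_le (hα : -1 < α) (hβ : -1 < β) (m r : ℕ) {g : ℝ → ℝ}
    (hg : ContDiff ℝ 2 g) {x : ℝ} (hx : x ∈ Icc (0:ℝ) 1) :
    |durrmeyerJ (α + r) (β + r) m g x - durrmeyerJ α β m g x| ≤
      (1 / 4) * supNorm (iteratedDeriv 2 g) *
          ((m + r + α + β + 3) / ((m + r + α + β + 3) ^ 2 - (r : ℝ) ^ 2))
        + modCont g (r * (m + |β - α|) / ((m + r + 2 + α + β) ^ 2 - (r : ℝ) ^ 2)) := by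
  have hc : Continuous (iteratedDeriv 2 g) := hg.continuous_iteratedDeriv 2 le_rfl
  have hr : (0:ℝ) ≤ r := r.cast_nonneg
  rw [durrmeyerJ_eq_sum, durrmeyerJ_eq_sum, ← Finset.sum_sub_distrib]
  simp only [← mul_sub]
  refine abs_sum_bern_mul_le m hx fun k hk => ?_
  have hk0 : (0:ℝ) ≤ k := k.cast_nonneg
  have hkm : (k:ℝ) ≤ m := by exact_mod_cast hk
  have ha := neg_one_lt_natCast_add hα k
  have hb := neg_one_lt_natCast_sub_add hβ hk
  have ha' := neg_one_lt_natCast_add (by linarith : -1 < α + r) k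
  have hb' := neg_one_lt_natCast_sub_add (by linarith : -1 < β + r) hk
  have t₁ := abs_jacobiMean_sub_le ha' hb' hg fun t ht => abs_le_supNorm hc ht
  have t₂ := abs_jacobiMean_sub_le ha hb hg fun t ht => abs_le_supNorm hc ht
  have hs : 0 < (m:ℝ) + α + β + 2 := by linarith
  rw [show (k:ℝ) + (α + r) + (m - k + (β + r)) + 2 = m + α + β + 2 * r + 2 by ring,
    show (k:ℝ) + (α + r) + (m - k + (β + r)) + 3 = m + α + β + 2 * r + 3 by ring,
    ← add_assoc (k:ℝ)] at t₁
  rw [show (k:ℝ) + α + (m - k + β) + 2 = m + α + β + 2 by ring,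
    show (k:ℝ) + α + (m - k + β) + 3 = m + α + β + 3 by ring] at t₂
  have hω := abs_sub_le_modCont hg.continuous
    (x := (k + α + r + 1) / (m + α + β + 2 * r + 2)) (y := (k + α + 1) / (m + α + β + 2))
    ⟨div_nonneg (by linarith) (by linarith), (div_le_one (by linarith)).2 (by linarith)⟩
    ⟨div_nonneg (by linarith) hs.le, (div_le_one hs).2 (by linarith)⟩
    (abs_mean_shift_sub_le hα hβ hk0 hkm hr)
  have e : supNorm (iteratedDeriv 2 g) / 8 * (1 / (m + α + β + 2 * r + 3)) +
      supNorm (iteratedDeriv 2 g) / 8 * (1 / (m + α + β + 3)) =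
      (1 / 4) * supNorm (iteratedDeriv 2 g) *
          ((m + r + α + β + 3) / ((m + r + α + β + 3) ^ 2 - (r : ℝ) ^ 2)) := by
    rw [show ((m:ℝ) + r + α + β + 3) ^ 2 - (r : ℝ) ^ 2 =
      (m + α + β + 2 * r + 3) * (m + α + β + 3) by ring]
    have : (m:ℝ) + α + β + 3 ≠ 0 := by linarith
    have : (m:ℝ) + α + β + 2 * r + 3 ≠ 0 := by linarith
    field_simp
    ring
  rw [← e, ← add_assoc (k:ℝ) α]
  rw [abs_le] at *
  constructor <;> linarith

end Difference

theorem durrmeyerJ_derivative_difference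
    (α β : ℝ) (hα : -1 < α) (hβ : -1 < β)
    (n r : ℕ) (hr : r ≤ n)
    (f : ℝ → ℝ) (hf : ContDiff ℝ (r + 2 : ℕ) f) :
    ∀ x ∈ Set.Icc (0:ℝ) 1,
      |iteratedDeriv r (durrmeyerJ α β n f) x
          - durrmeyerJ α β (n - r) (iteratedDeriv r f) x| ≤
        (r : ℝ) * (α + β + (r : ℝ) + 1) / ((n : ℝ) + α + β + 2) * supNorm (iteratedDeriv r f)
          + (1 / 4) * supNorm (iteratedDeriv (r + 2) f) *
              (((n : ℝ) + α + β + 3) / (((n : ℝ) + α + β + 3) ^ 2 - (r : ℝ) ^ 2))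
          + modCont (iteratedDeriv r f)
              ((r : ℝ) * ((n : ℝ) - (r : ℝ) + |β - α|) /
                (((n : ℝ) + 2 + α + β) ^ 2 - (r : ℝ) ^ 2)) := by
  intro x hx
  obtain ⟨m, rfl⟩ := Nat.exists_eq_add_of_le' hr
  obtain ⟨γ, -, h1, hγ, e⟩ := iteratedDeriv_durrmeyerJ r hα hβ m
    (hf.of_le (by exact_mod_cast Nat.le_add_right r 2))
  have hg : ContDiff ℝ 2 (iteratedDeriv r f) := by
    rw [iteratedDeriv_eq_iterate]
    exact ContDiff.iterate_deriv' 2 r (by rwa [Nat.add_comm] at hf)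
  have h2 : iteratedDeriv (r + 2) f = iteratedDeriv 2 (iteratedDeriv r f) := by
    simp only [iteratedDeriv_eq_iterate, ← Function.iterate_add_apply, Nat.add_comm]
  have hr0 : (0:ℝ) ≤ r := r.cast_nonneg
  have hD := abs_durrmeyerJ_shift_sub_le hα hβ m r hg hx
  have hN := abs_durrmeyerJ_le_supNorm (by linarith : -1 < α + r) (by linarith : -1 < β + r) m
    hg.continuous hx
  rw [e, h2, Nat.add_sub_cancel]
  have hS : 0 ≤ supNorm (iteratedDeriv r f) := (abs_nonneg _).trans hN
  have hγS := mul_le_mul_of_nonneg_right hγ hS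
  set g := iteratedDeriv r f
  have key : |γ * durrmeyerJ (α + r) (β + r) m g x - durrmeyerJ α β m g x| ≤
      (1 - γ) * supNorm g + |durrmeyerJ (α + r) (β + r) m g x - durrmeyerJ α β m g x| := by
    calc _ = |-((1 - γ) * durrmeyerJ (α + r) (β + r) m g x) +
            (durrmeyerJ (α + r) (β + r) m g x - durrmeyerJ α β m g x)| := by congr 1; ring
      _ ≤ _ := by
        refine (abs_add_le _ _).trans ?_
        rw [abs_neg, abs_mul, abs_of_nonneg (sub_nonneg.2 h1)]
        gcongr
  push_cast at hγS ⊢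
  rw [add_sub_cancel_right]
  linarith
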